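/- Let ℓ, n ≥ 1 and let x_1,…,x_n, t_1,…,t_ℓ be positive real numbers with x_i < t_j for all 1 ≤ i ≤ n and 1 ≤ j ≤ ℓ. Then the series Σ_λ (∏_{i=1}^{ℓ} t_i^{−λ_i}) · g_λ(x_1,…,x_n; t_1,…,t_{ℓ−1}), summed over all partitions λ with at most ℓ parts, converges and equals ∏_{i=1}^{n} ∏_{j=1}^{ℓ} t_j/(t_j − x_i). -/

import Mathlib

open scoped Classical

noncomputable section

variable {R : Type*} [CommRing R]

/-- The boxes of the Young diagram with row lengths `lam 0, …, lam (ℓ-1)`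
(a box in row `r < ℓ` and column `c < lam r`, both 0-indexed). -/
abbrev YBox (ℓ : ℕ) (lam : ℕ → ℕ) : Type := Σ r : Fin ℓ, Fin (lam r.1)

/-- A reverse plane partition of skew shape `lam/mu` with entries in `{1, …, n}`,
encoded as a filling of the boxes of `lam` by values in `Fin (n+1)`, where the
value `0` is used exactly on the boxes of `mu`; rows weakly increase and
columns weakly increase. -/
def IsSkewRPP (ℓ n : ℕ) (lam mu : ℕ → ℕ) (T : YBox ℓ lam → Fin (n + 1)) : Prop :=
  (∀ b : YBox ℓ lam, ((T b : ℕ) = 0 ↔ (b.2 : ℕ) < mu b.1.1)) ∧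
  (∀ (r : Fin ℓ) (c c' : Fin (lam r.1)), mu r.1 ≤ (c : ℕ) → (c : ℕ) ≤ (c' : ℕ) →
    T ⟨r, c⟩ ≤ T ⟨r, c'⟩) ∧
  (∀ (r r' : Fin ℓ) (c : Fin (lam r.1)) (c' : Fin (lam r'.1)),
    (r : ℕ) ≤ (r' : ℕ) → (c : ℕ) = (c' : ℕ) → mu r.1 ≤ (c : ℕ) → mu r'.1 ≤ (c' : ℕ) →
    T ⟨r, c⟩ ≤ T ⟨r', c'⟩)

/-- The weight of a box `b` of the skew shape `lam/mu` in a reverse plane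
partition `T`: it is `t (r+1)` (`r+1` being the 1-indexed row of `b`) if the box
directly below `b` exists (in `lam`) and carries the same entry, and `x e`
otherwise, where `e ∈ {1, …, n}` is the entry of `b`.  Boxes of `mu` have
weight `1`. -/
def boxWeight (ℓ n : ℕ) (lam mu : ℕ → ℕ) (x t : ℕ → R)
    (T : YBox ℓ lam → Fin (n + 1)) (b : YBox ℓ lam) : R :=
  if mu b.1.1 ≤ (b.2 : ℕ) then
    if ∃ (hr : (b.1 : ℕ) + 1 < ℓ) (hc : (b.2 : ℕ) < lam ((b.1 : ℕ) + 1)),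
        T ⟨⟨(b.1 : ℕ) + 1, hr⟩, ⟨(b.2 : ℕ), hc⟩⟩ = T b
      then t ((b.1 : ℕ) + 1)
      else x (T b : ℕ)
  else 1

/-- The (skew) refined dual Grothendieck polynomial `g_{lam/mu}(x; t)`:
the sum of `∏_r t_r^{b_r(T)} ∏_i x_i^{a_i(T)}` over all reverse plane
partitions `T` of shape `lam/mu` with entries in `{1, …, n}`, where `b_r(T)`
is the number of boxes in row `r` whose entry equals that of the box directly
below it, and `a_i(T)` is the number of columns containing the entry `i`. -/
def dualGroth (ℓ n : ℕ) (lam mu : ℕ → ℕ) (x t : ℕ → R) : R :=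
  ∑ T ∈ Finset.univ.filter (IsSkewRPP ℓ n lam mu),
    ∏ b : YBox ℓ lam, boxWeight ℓ n lam mu x t T b

/-- Complete homogeneous symmetric function `h_k` of the entries of a list. -/
def hL (k : ℕ) (L : List R) : R :=
  ∑ f ∈ Finset.univ.filter (fun f : Fin k → Fin L.length => Monotone f),
    ∏ i, L.get (f i)

/-- Elementary symmetric function `e_k` of the entries of a list. -/
def eL (k : ℕ) (L : List R) : R :=
  ∑ f ∈ Finset.univ.filter (fun f : Fin k → Fin L.length => StrictMono f),
    ∏ i, L.get (f i)

/-- `h_d` for an integer degree `d`, with `h_d = 0` for `d < 0`. -/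
def hInt (d : ℤ) (L : List R) : R := if 0 ≤ d then hL d.toNat L else 0

/-- `e_d` for an integer degree `d`, with `e_d = 0` for `d < 0`. -/
def eInt (d : ℤ) (L : List R) : R := if 0 ≤ d then eL d.toNat L else 0

/-- Extend a function on `Fin ℓ` to `ℕ` by `0`. -/
def extendFin (ℓ : ℕ) (p : Fin ℓ → ℕ) : ℕ → ℕ :=
  fun r => if h : r < ℓ then p ⟨r, h⟩ else 0

/-- A semistandard Young tableau of shape `lam` with entries in `{1, …, N}`
(encoded with values in `Fin (N+1)`, the value `0` being unused): rows weakly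
increase and columns strictly increase. -/
def IsSSYT (ℓ N : ℕ) (lam : ℕ → ℕ) (T : YBox ℓ lam → Fin (N + 1)) : Prop :=
  (∀ b : YBox ℓ lam, 1 ≤ (T b : ℕ)) ∧
  (∀ (r : Fin ℓ) (c c' : Fin (lam r.1)), (c : ℕ) ≤ (c' : ℕ) → T ⟨r, c⟩ ≤ T ⟨r, c'⟩) ∧
  (∀ (r r' : Fin ℓ) (c : Fin (lam r.1)) (c' : Fin (lam r'.1)),
    (r : ℕ) < (r' : ℕ) → (c : ℕ) = (c' : ℕ) → T ⟨r, c⟩ < T ⟨r', c'⟩)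

/-- The Schur polynomial `s_lam (z 1, …, z N)`: the sum of `z^T` over all
semistandard Young tableaux of shape `lam` with entries in `{1, …, N}`. -/
def schurPoly (ℓ N : ℕ) (lam : ℕ → ℕ) (z : ℕ → R) : R :=
  ∑ T ∈ Finset.univ.filter (IsSSYT ℓ N lam),
    ∏ b : YBox ℓ lam, z (T b : ℕ)


theorem hasSum_congr_fun {β : Type*} {f g : β → ℝ} {s : ℝ} (h : ∀ b, f b = g b) :
    HasSum f s ↔ HasSum g s := by
  rw [funext h]

/-- A nonnegative double series may be summed iteratively. -/
theorem hasSum_prod_of_nonneg {α β : Type*} {f : α × β → ℝ} {g : α → ℝ} {s : ℝ}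
    (hf : ∀ a b, 0 ≤ f (a, b)) (hg : ∀ a, HasSum (fun b => f (a, b)) (g a)) (hs : HasSum g s) :
    HasSum f s := by
  have hsum : Summable f := by
    rw [summable_prod_of_nonneg (fun p => hf p.1 p.2)]
    refine ⟨fun a => (hg a).summable, ?_⟩
    convert hs.summable using 2 with a
    exact (hg a).tsum_eq
  have h := hsum.hasSum.prod_fiberwise hg
  rw [← h.unique hs]
  exact hsum.hasSum

/-- Exchange of the order of summation for nonnegative double series. -/
theorem hasSum_comm_of_nonneg {α β : Type*} {f : α → β → ℝ} {g : α → ℝ} {h : β → ℝ} {s : ℝ}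
    (hf : ∀ a b, 0 ≤ f a b) (hg : ∀ a, HasSum (f a) (g a)) (hs : HasSum g s)
    (hh : ∀ b, HasSum (fun a => f a b) (h b)) : HasSum h s := by
  have H : HasSum (fun p : α × β => f p.1 p.2) s := hasSum_prod_of_nonneg hf hg hs
  exact ((Equiv.prodComm β α).hasSum_iff.mpr H).prod_fiberwise hh

theorem extendFin_of_lt {ℓ : ℕ} (p : Fin ℓ → ℕ) (r : Fin ℓ) : extendFin ℓ p r = p r := by
  simp [extendFin]

theorem extendFin_cons_succ (ℓ k : ℕ) (p : Fin ℓ → ℕ) (m : ℕ) :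
    extendFin (ℓ + 1) (Fin.cons k p) (m + 1) = extendFin ℓ p m := by
  unfold extendFin
  by_cases h : m < ℓ
  · rw [dif_pos h, dif_pos (by omega)]
    exact Fin.cons_succ (α := fun _ => ℕ) k p ⟨m, h⟩
  · rw [dif_neg h, dif_neg (by omega)]

/-- A chain of nonnegative series, each of whose sums does not depend on the next index,
sums to the product. -/
theorem hasSum_prod_chain : ∀ (ℓ : ℕ) (a : Fin ℓ → ℕ → ℕ → ℝ) (c : Fin ℓ → ℝ),
    (∀ r k k', 0 ≤ a r k k') → (∀ r k', HasSum (fun k => a r k k') (c r)) →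
    HasSum (fun p : Fin ℓ → ℕ => ∏ r, a r (p r) (extendFin ℓ p (r + 1))) (∏ r, c r)
  | 0, a, c, _, _ => by
    simp
  | ℓ + 1, a, c, ha, hc => by
    have ih := hasSum_prod_chain ℓ (fun r => a r.succ) (fun r => c r.succ)
      (fun r => ha _) (fun r => hc _)
    let e : (Fin ℓ → ℕ) × ℕ ≃ (Fin (ℓ + 1) → ℕ) :=
      (Equiv.prodComm _ _).trans (Fin.consEquiv (fun _ => ℕ))
    rw [← e.hasSum_iff, Fin.prod_univ_succ]
    refine hasSum_prod_of_nonneg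
      (g := fun p => c 0 * ∏ r : Fin ℓ, a r.succ (p r) (extendFin ℓ p (r + 1))) ?_ ?_
      (ih.mul_left _)
    · intro p k
      exact Finset.prod_nonneg fun r _ => ha _ _ _
    · intro p
      refine (hasSum_congr_fun fun k => ?_).mpr ((hc 0 (extendFin ℓ p 0)).mul_right
        (∏ r : Fin ℓ, a r.succ (p r) (extendFin ℓ p (r + 1))))
      have he : e (p, k) = Fin.cons k p := rfl
      simp only [Function.comp_apply, he, Fin.prod_univ_succ, Fin.cons_zero, Fin.cons_succ,
        extendFin_cons_succ, Fin.val_zero, Fin.val_succ]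

/-- The contribution of one row to the skew polynomial in a single variable `y`, normalized by a
power of `s`: the row has inner length `m`, outer length `k`, and the next row has outer
length `k'`. -/
def rowKernel (s y : ℝ) (m k k' : ℕ) : ℝ :=
  if m ≤ k ∧ k' ≤ k then s⁻¹ ^ k * (s ^ (k' - m) * y ^ (k - max m k')) else 0

theorem rowKernel_nonneg {s y : ℝ} (hs : 0 ≤ s) (hy : 0 ≤ y) (m k k' : ℕ) :
    0 ≤ rowKernel s y m k k' := by
  unfold rowKernel
  split_ifs <;> positivity

theorem hasSum_rowKernel {s y : ℝ} (hy : 0 < y) (hys : y < s) (m k' : ℕ) :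
    HasSum (fun k => rowKernel s y m k k') (s⁻¹ ^ m * (s / (s - y))) := by
  have hs : 0 < s := hy.trans hys
  have hgeo := (hasSum_geometric_of_lt_one (div_pos hy hs).le
    ((div_lt_one hs).mpr hys)).mul_left (s⁻¹ ^ m)
  have e : (1 - y / s)⁻¹ = s / (s - y) := by
    rw [one_sub_div hs.ne', inv_div]
  rw [e] at hgeo
  have hinj : Function.Injective (fun j : ℕ => j + max m k') := add_left_injective _
  rw [← hinj.hasSum_iff]
  · refine (hasSum_congr_fun fun j => ?_).mpr hgeo
    simp only [Function.comp_apply, rowKernel]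
    rw [if_pos (by omega), Nat.add_sub_cancel, div_pow]
    have : max m k' = m + (k' - m) := by omega
    rw [this, pow_add, pow_add, inv_pow, inv_pow, inv_pow]
    field_simp
  · intro k hk
    refine if_neg fun h => hk ⟨k - max m k', ?_⟩
    change k - max m k' + max m k' = k
    omega

/-- Partitions with at most `ℓ` parts. -/
abbrev Parts (ℓ : ℕ) : Type := {p : Fin ℓ → ℕ // ∀ i j : Fin ℓ, (i : ℕ) ≤ (j : ℕ) → p j ≤ p i}

theorem Parts.extendFin_anti {ℓ : ℕ} (p : Parts ℓ) {i j : ℕ} (h : i ≤ j) :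
    extendFin ℓ p.1 j ≤ extendFin ℓ p.1 i := by
  unfold extendFin
  split_ifs with h1 h2
  · exact p.2 _ _ h
  · omega
  · exact Nat.zero_le _
  · exact le_rfl

/-- Summing the one-variable transition weights over all outer partitions. -/
theorem hasSum_transition (ℓ : ℕ) (t : ℕ → ℝ) (y : ℝ) (hy : 0 < y)
    (hyt : ∀ r : Fin ℓ, y < t (r + 1)) (mu : Parts ℓ) :
    HasSum (fun p : Parts ℓ =>
        ∏ r : Fin ℓ, rowKernel (t (r + 1)) y (mu.1 r) (p.1 r) (extendFin ℓ p.1 (r + 1)))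
      ((∏ r : Fin ℓ, (t (r + 1))⁻¹ ^ mu.1 r) * ∏ r : Fin ℓ, t (r + 1) / (t (r + 1) - y)) := by
  rw [← Finset.prod_mul_distrib]
  have H := hasSum_prod_chain ℓ (fun r => rowKernel (t (r + 1)) y (mu.1 r))
    (fun r => (t (r + 1))⁻¹ ^ mu.1 r * (t (r + 1) / (t (r + 1) - y)))
    (fun r => rowKernel_nonneg (hy.trans (hyt r)).le hy.le _)
    (fun r => hasSum_rowKernel hy (hyt r) _)
  refine (hasSum_subtype_iff_of_support_subset (s := {p : Fin ℓ → ℕ |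
    ∀ i j : Fin ℓ, (i : ℕ) ≤ (j : ℕ) → p j ≤ p i}) ?_).mpr H
  intro p hp
  have hstep : ∀ r : Fin ℓ, extendFin ℓ p (r + 1) ≤ extendFin ℓ p r := by
    intro r
    have := Finset.prod_ne_zero_iff.mp hp r (Finset.mem_univ _)
    rw [extendFin_of_lt p r]
    by_contra hcon
    exact this (if_neg fun h => hcon h.2)
  have hanti : Antitone (extendFin ℓ p) := by
    refine antitone_nat_of_succ_le fun r => ?_
    by_cases h : r < ℓ
    · exact hstep ⟨r, h⟩
    · simp [extendFin, show ¬ r + 1 < ℓ by omega]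
  intro i j hij
  have := hanti hij
  rwa [extendFin_of_lt, extendFin_of_lt] at this

/-- `mu` is the shape formed by the boxes of `T` not containing the largest entry. -/
def IsInner (ℓ n : ℕ) (lam mu : ℕ → ℕ) (T : YBox ℓ lam → Fin (n + 2)) : Prop :=
  (∀ r : Fin ℓ, mu r ≤ lam r) ∧ ∀ b : YBox ℓ lam, T b ≠ Fin.last (n + 1) ↔ (b.2 : ℕ) < mu b.1

theorem exists_isInner (ℓ n : ℕ) (lam : Parts ℓ) (T : YBox ℓ (extendFin ℓ lam.1) → Fin (n + 2))
    (hT : IsSkewRPP ℓ (n + 1) (extendFin ℓ lam.1) (fun _ => 0) T) :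
    ∃ mu : Parts ℓ, IsInner ℓ n (extendFin ℓ lam.1) (extendFin ℓ mu.1) T := by
  obtain ⟨-, hrow, hcol⟩ := hT
  let S : Fin ℓ → Set ℕ := fun r =>
    {m | ∀ c : Fin (extendFin ℓ lam.1 r), m ≤ c → T ⟨r, c⟩ = Fin.last (n + 1)}
  have hlam : ∀ r, extendFin ℓ lam.1 r ∈ S r := fun r c hc => absurd c.2 (by omega)
  have hmem : ∀ r, sInf (S r) ∈ S r := fun r => Nat.sInf_mem ⟨_, hlam r⟩
  refine ⟨⟨fun r => sInf (S r), fun r s hrs => Nat.sInf_le fun c hc => ?_⟩, ?_, ?_⟩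
  · have hc' : (c : ℕ) < extendFin ℓ lam.1 r := c.2.trans_le (lam.extendFin_anti hrs)
    have h1 := hmem r ⟨c, hc'⟩ hc
    have h2 := hcol r s ⟨c, hc'⟩ c hrs rfl (Nat.zero_le _) (Nat.zero_le _)
    rw [h1] at h2
    exact Fin.last_le_iff.mp h2
  · intro r
    rw [extendFin_of_lt]
    exact Nat.sInf_le (hlam r)
  · rintro ⟨r, c⟩
    change _ ↔ (c : ℕ) < extendFin ℓ (fun r => sInf (S r)) r
    rw [extendFin_of_lt (fun r => sInf (S r))]
    constructor
    · intro h
      by_contra hcon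
      exact h (hmem r c (not_lt.mp hcon))
    · intro h hlast
      refine Nat.notMem_of_lt_sInf h fun c' hc' => ?_
      have h2 := hrow r c c' (Nat.zero_le _) hc'
      rw [hlast] at h2
      exact Fin.last_le_iff.mp h2

theorem IsInner.le {ℓ n : ℕ} {lam mu mu' : ℕ → ℕ} {T : YBox ℓ lam → Fin (n + 2)}
    (h : IsInner ℓ n lam mu T) (h' : IsInner ℓ n lam mu' T) (r : Fin ℓ) : mu r ≤ mu' r := by
  by_contra! hlt
  have hc : mu' r < lam r := hlt.trans_le (h.1 r)
  exact lt_irrefl _ ((h'.2 ⟨r, ⟨mu' r, hc⟩⟩).mp ((h.2 ⟨r, ⟨mu' r, hc⟩⟩).mpr hlt))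

theorem IsInner.unique {ℓ n : ℕ} {lam : ℕ → ℕ} {mu mu' : Parts ℓ} {T : YBox ℓ lam → Fin (n + 2)}
    (h : IsInner ℓ n lam (extendFin ℓ mu.1) T) (h' : IsInner ℓ n lam (extendFin ℓ mu'.1) T) :
    mu = mu' := by
  refine Subtype.ext (funext fun r => ?_)
  rw [← extendFin_of_lt mu.1, ← extendFin_of_lt mu'.1]
  exact le_antisymm (h.le h' r) (h'.le h r)

/-- Extend a filling of `mu` to a filling of `lam` by the new largest entry. -/
def extendFilling (ℓ n : ℕ) (lam mu : ℕ → ℕ) (S : YBox ℓ mu → Fin (n + 1)) (b : YBox ℓ lam) :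
    Fin (n + 2) :=
  if h : (b.2 : ℕ) < mu b.1 then (S ⟨b.1, ⟨b.2, h⟩⟩).castSucc else Fin.last (n + 1)

theorem extendFilling_of_lt {ℓ n : ℕ} {lam mu : ℕ → ℕ} (S : YBox ℓ mu → Fin (n + 1))
    {b : YBox ℓ lam} (h : (b.2 : ℕ) < mu b.1) :
    extendFilling ℓ n lam mu S b = (S ⟨b.1, ⟨b.2, h⟩⟩).castSucc := dif_pos h

theorem extendFilling_of_not_lt {ℓ n : ℕ} {lam mu : ℕ → ℕ} (S : YBox ℓ mu → Fin (n + 1))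
    {b : YBox ℓ lam} (h : ¬ (b.2 : ℕ) < mu b.1) :
    extendFilling ℓ n lam mu S b = Fin.last (n + 1) := dif_neg h

theorem isInner_extendFilling {ℓ n : ℕ} {lam mu : ℕ → ℕ} (hle : ∀ r : Fin ℓ, mu r ≤ lam r)
    (S : YBox ℓ mu → Fin (n + 1)) : IsInner ℓ n lam mu (extendFilling ℓ n lam mu S) := by
  refine ⟨hle, fun b => ?_⟩
  by_cases h : (b.2 : ℕ) < mu b.1
  · simp [extendFilling_of_lt S h, h, Fin.castSucc_ne_last]
  · simp [extendFilling_of_not_lt S h, h]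

theorem isSkewRPP_extendFilling {ℓ n : ℕ} {lam mu : ℕ → ℕ} (hmu : Antitone mu)
    {S : YBox ℓ mu → Fin (n + 1)} (hS : IsSkewRPP ℓ n mu (fun _ => 0) S) :
    IsSkewRPP ℓ (n + 1) lam (fun _ => 0) (extendFilling ℓ n lam mu S) := by
  obtain ⟨h0, hrow, hcol⟩ := hS
  refine ⟨fun b => ?_, fun r c c' _ hcc => ?_, fun r r' c c' hrr hcc _ _ => ?_⟩
  · by_cases h : (b.2 : ℕ) < mu b.1
    · rw [extendFilling_of_lt S h]
      exact h0 _
    · simp [extendFilling_of_not_lt S h]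
  · by_cases h : (c' : ℕ) < mu r
    · rw [extendFilling_of_lt (b := ⟨r, c'⟩) S h,
        extendFilling_of_lt (b := ⟨r, c⟩) S (hcc.trans_lt h), Fin.castSucc_le_castSucc_iff]
      exact hrow r _ _ (Nat.zero_le _) hcc
    · rw [extendFilling_of_not_lt (b := ⟨r, c'⟩) S h]
      exact Fin.le_last _
  · by_cases h : (c' : ℕ) < mu r'
    · have h' : (c : ℕ) < mu r := hcc ▸ h.trans_le (hmu hrr)
      rw [extendFilling_of_lt (b := ⟨r', c'⟩) S h, extendFilling_of_lt (b := ⟨r, c⟩) S h',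
        Fin.castSucc_le_castSucc_iff]
      exact hcol r r' _ _ hrr hcc (Nat.zero_le _) (Nat.zero_le _)
    · rw [extendFilling_of_not_lt (b := ⟨r', c'⟩) S h]
      exact Fin.le_last _

theorem extendFilling_injective {ℓ n : ℕ} {lam mu : ℕ → ℕ} (hle : ∀ r : Fin ℓ, mu r ≤ lam r) :
    Function.Injective (extendFilling ℓ n lam mu) := by
  intro S S' h
  funext b
  let b' : YBox ℓ lam := ⟨b.1, ⟨b.2, b.2.2.trans_le (hle b.1)⟩⟩
  have hb := congrFun h b'
  rw [extendFilling_of_lt (b := b') S b.2.2, extendFilling_of_lt (b := b') S' b.2.2] at hb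
  exact Fin.castSucc_injective _ hb

theorem exists_extendFilling_eq {ℓ n : ℕ} {lam mu : ℕ → ℕ} {T : YBox ℓ lam → Fin (n + 2)}
    (hT : IsSkewRPP ℓ (n + 1) lam (fun _ => 0) T) (hin : IsInner ℓ n lam mu T) :
    ∃ S, IsSkewRPP ℓ n mu (fun _ => 0) S ∧ extendFilling ℓ n lam mu S = T := by
  obtain ⟨h0, hrow, hcol⟩ := hT
  obtain ⟨hle, hin⟩ := hin
  let e : YBox ℓ mu → YBox ℓ lam := fun b => ⟨b.1, ⟨b.2, b.2.2.trans_le (hle b.1)⟩⟩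
  have he : ∀ b, T (e b) ≠ Fin.last (n + 1) := fun b => (hin (e b)).mpr b.2.2
  refine ⟨fun b => (T (e b)).castPred (he b),
    ⟨fun b => h0 (e b), fun r c c' _ hcc => ?_, fun r r' c c' hrr hcc _ _ => ?_⟩, ?_⟩
  · exact hrow r _ _ (Nat.zero_le _) hcc
  · exact hcol r r' _ _ hrr hcc (Nat.zero_le _) (Nat.zero_le _)
  · funext b
    by_cases h : (b.2 : ℕ) < mu b.1
    · rw [extendFilling_of_lt _ h, Fin.castSucc_castPred]
    · rw [extendFilling_of_not_lt _ h]
      by_contra hne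
      exact h ((hin b).mp (Ne.symm hne))

theorem prod_ite_Ico (s y : ℝ) {m k k' : ℕ} (hk : k' ≤ k) :
    ∏ c ∈ Finset.Ico m k, (if c < k' then s else y) = s ^ (k' - m) * y ^ (k - max m k') := by
  rw [Finset.prod_ite, Finset.prod_const, Finset.prod_const]
  congr 2
  · rw [show (Finset.Ico m k).filter (fun c => c < k') = Finset.Ico m k' by
      ext c; simp only [Finset.mem_filter, Finset.mem_Ico]; omega, Nat.card_Ico]
  · rw [show (Finset.Ico m k).filter (fun c => ¬ c < k') = Finset.Ico (max m k') k by
      ext c; simp only [Finset.mem_filter, Finset.mem_Ico]; omega, Nat.card_Ico]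

theorem boxWeight_extendFilling_of_lt {ℓ n : ℕ} {lam mu : ℕ → ℕ} (x t : ℕ → ℝ)
    (hle : ∀ r : Fin ℓ, mu r ≤ lam r) (S : YBox ℓ mu → Fin (n + 1)) {b : YBox ℓ lam}
    (h : (b.2 : ℕ) < mu b.1) :
    boxWeight ℓ (n + 1) lam (fun _ => 0) x t (extendFilling ℓ n lam mu S) b =
      boxWeight ℓ n mu (fun _ => 0) x t S ⟨b.1, ⟨b.2, h⟩⟩ := by
  unfold boxWeight
  simp only [Nat.zero_le, if_true]
  rw [extendFilling_of_lt S h]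
  refine if_congr ⟨?_, ?_⟩ rfl rfl
  · rintro ⟨hr, hc, heq⟩
    by_cases hc' : (b.2 : ℕ) < mu (b.1 + 1)
    · rw [extendFilling_of_lt (b := ⟨⟨b.1 + 1, hr⟩, ⟨b.2, hc⟩⟩) S hc'] at heq
      exact ⟨hr, hc', Fin.castSucc_injective _ heq⟩
    · rw [extendFilling_of_not_lt (b := ⟨⟨b.1 + 1, hr⟩, ⟨b.2, hc⟩⟩) S hc'] at heq
      exact absurd heq.symm (Fin.castSucc_ne_last _)
  · rintro ⟨hr, hc, heq⟩
    refine ⟨hr, hc.trans_le (hle ⟨b.1 + 1, hr⟩), ?_⟩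
    rw [extendFilling_of_lt (b := ⟨⟨b.1 + 1, hr⟩, ⟨b.2, _⟩⟩) S hc, heq]

theorem boxWeight_extendFilling_of_not_lt {ℓ n : ℕ} (lam : Fin ℓ → ℕ) {mu : ℕ → ℕ} (x t : ℕ → ℝ)
    (hmu : Antitone mu) (S : YBox ℓ mu → Fin (n + 1)) {b : YBox ℓ (extendFin ℓ lam)}
    (h : ¬ (b.2 : ℕ) < mu b.1) :
    boxWeight ℓ (n + 1) (extendFin ℓ lam) (fun _ => 0) x t
        (extendFilling ℓ n (extendFin ℓ lam) mu S) b =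
      if (b.2 : ℕ) < extendFin ℓ lam (b.1 + 1) then t (b.1 + 1) else x (n + 1) := by
  unfold boxWeight
  simp only [Nat.zero_le, if_true]
  rw [extendFilling_of_not_lt S h, Fin.val_last]
  refine if_congr ⟨fun ⟨_, hc, _⟩ => hc, fun hc => ?_⟩ rfl rfl
  have hr : (b.1 : ℕ) + 1 < ℓ := by
    by_contra hr
    simp [extendFin, hr] at hc
  refine ⟨hr, hc, extendFilling_of_not_lt S fun hlt => h (hlt.trans_le ?_)⟩
  exact hmu (Nat.le_succ _)

theorem prod_boxWeight_extendFilling {ℓ n : ℕ} (lam mu : Parts ℓ) (x t : ℕ → ℝ)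
    (hle : ∀ r : Fin ℓ, extendFin ℓ mu.1 r ≤ extendFin ℓ lam.1 r)
    (S : YBox ℓ (extendFin ℓ mu.1) → Fin (n + 1)) :
    ∏ b, boxWeight ℓ (n + 1) (extendFin ℓ lam.1) (fun _ => 0) x t
        (extendFilling ℓ n (extendFin ℓ lam.1) (extendFin ℓ mu.1) S) b =
      (∏ b, boxWeight ℓ n (extendFin ℓ mu.1) (fun _ => 0) x t S b) *
        ∏ r : Fin ℓ, (t (r + 1) ^ (extendFin ℓ lam.1 (r + 1) - mu.1 r) *
          x (n + 1) ^ (lam.1 r - max (mu.1 r) (extendFin ℓ lam.1 (r + 1)))) := by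
  rw [Fintype.prod_sigma, Fintype.prod_sigma, ← Finset.prod_mul_distrib]
  refine Finset.prod_congr rfl fun r _ => ?_
  have hmu : Antitone (extendFin ℓ mu.1) := fun _ _ => mu.extendFin_anti
  let F : ℕ → ℝ := fun c =>
    if h : c < extendFin ℓ mu.1 r then
      boxWeight ℓ n (extendFin ℓ mu.1) (fun _ => 0) x t S ⟨r, ⟨c, h⟩⟩
    else if c < extendFin ℓ lam.1 (r + 1) then t (r + 1) else x (n + 1)
  have h1 : ∀ c : Fin (extendFin ℓ lam.1 r),
      boxWeight ℓ (n + 1) (extendFin ℓ lam.1) (fun _ => 0) x t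
        (extendFilling ℓ n (extendFin ℓ lam.1) (extendFin ℓ mu.1) S) ⟨r, c⟩ = F c := by
    intro c
    by_cases h : (c : ℕ) < extendFin ℓ mu.1 r
    · rw [boxWeight_extendFilling_of_lt (b := ⟨r, c⟩) x t hle S h]
      simp only [F, dif_pos h]
    · rw [boxWeight_extendFilling_of_not_lt (b := ⟨r, c⟩) lam.1 x t hmu S h]
      simp only [F, dif_neg h]
  have h2 : ∀ c : Fin (extendFin ℓ mu.1 r),
      boxWeight ℓ n (extendFin ℓ mu.1) (fun _ => 0) x t S ⟨r, c⟩ = F c := by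
    intro c
    simp only [F, dif_pos c.2]
  rw [Finset.prod_congr rfl fun c _ => h1 c, Finset.prod_congr rfl fun c _ => h2 c,
    Fin.prod_univ_eq_prod_range, Fin.prod_univ_eq_prod_range,
    ← Finset.prod_range_mul_prod_Ico F (hle r), ← extendFin_of_lt lam.1 r,
    ← extendFin_of_lt mu.1 r,
    ← prod_ite_Ico (t (r + 1)) (x (n + 1)) (lam.extendFin_anti (Nat.le_succ _))]
  congr 1
  refine Finset.prod_congr rfl fun c hc => ?_
  simp only [F, dif_neg (not_lt.mpr (Finset.mem_Ico.mp hc).1)]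

/-- The sum over the reverse plane partitions with prescribed inner shape `mu`. -/
theorem sum_isInner {ℓ n : ℕ} (lam mu : Parts ℓ) (x t : ℕ → ℝ) :
    (∏ r : Fin ℓ, (t (r + 1))⁻¹ ^ lam.1 r) *
      (∑ T ∈ Finset.univ.filter (IsSkewRPP ℓ (n + 1) (extendFin ℓ lam.1) (fun _ => 0)),
        if IsInner ℓ n (extendFin ℓ lam.1) (extendFin ℓ mu.1) T then
          ∏ b, boxWeight ℓ (n + 1) (extendFin ℓ lam.1) (fun _ => 0) x t T b else 0) =
      dualGroth ℓ n (extendFin ℓ mu.1) (fun _ => 0) x t *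
        ∏ r : Fin ℓ, rowKernel (t (r + 1)) (x (n + 1)) (mu.1 r) (lam.1 r)
          (extendFin ℓ lam.1 (r + 1)) := by
  by_cases hle : ∀ r : Fin ℓ, extendFin ℓ mu.1 r ≤ extendFin ℓ lam.1 r
  · have hK : ∀ r : Fin ℓ, rowKernel (t (r + 1)) (x (n + 1)) (mu.1 r) (lam.1 r)
          (extendFin ℓ lam.1 (r + 1)) = (t (r + 1))⁻¹ ^ lam.1 r *
          (t (r + 1) ^ (extendFin ℓ lam.1 (r + 1) - mu.1 r) *
          x (n + 1) ^ (lam.1 r - max (mu.1 r) (extendFin ℓ lam.1 (r + 1)))) := by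
      intro r
      refine if_pos ⟨?_, ?_⟩
      · simpa only [extendFin_of_lt] using hle r
      · rw [← extendFin_of_lt lam.1 r]
        exact lam.extendFin_anti (Nat.le_succ _)
    rw [Finset.prod_congr rfl fun r _ => hK r, Finset.prod_mul_distrib, mul_left_comm]
    congr 1
    rw [← Finset.sum_filter, Finset.filter_filter, dualGroth, Finset.sum_mul]
    symm
    refine Finset.sum_bij (fun S _ => extendFilling ℓ n (extendFin ℓ lam.1) (extendFin ℓ mu.1) S)
      ?_ ?_ ?_ ?_
    · intro S hS
      simp only [Finset.mem_filter, Finset.mem_univ, true_and] at hS ⊢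
      exact ⟨isSkewRPP_extendFilling (fun _ _ => mu.extendFin_anti) hS,
        isInner_extendFilling hle S⟩
    · intro S _ S' _ h
      exact extendFilling_injective hle h
    · intro T hT
      simp only [Finset.mem_filter, Finset.mem_univ, true_and] at hT
      obtain ⟨S, hS, rfl⟩ := exists_extendFilling_eq hT.1 hT.2
      exact ⟨S, by simpa using hS, rfl⟩
    · intro S _
      exact (prod_boxWeight_extendFilling lam mu x t hle S).symm
  · rw [Finset.sum_eq_zero fun T _ => if_neg fun h => hle h.1, mul_zero]
    push Not at hle
    obtain ⟨r, hr⟩ := hle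
    rw [extendFin_of_lt, extendFin_of_lt] at hr
    rw [Finset.prod_eq_zero (Finset.mem_univ r) (if_neg fun h => absurd h.1 (not_le.mpr hr)),
      mul_zero]

/-- The branching rule of refined dual Grothendieck polynomials. -/
theorem hasSum_branching {ℓ n : ℕ} (lam : Parts ℓ) (x t : ℕ → ℝ) :
    HasSum (fun mu : Parts ℓ => dualGroth ℓ n (extendFin ℓ mu.1) (fun _ => 0) x t *
        ∏ r : Fin ℓ, rowKernel (t (r + 1)) (x (n + 1)) (mu.1 r) (lam.1 r)
          (extendFin ℓ lam.1 (r + 1)))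
      ((∏ r : Fin ℓ, (t (r + 1))⁻¹ ^ lam.1 r) *
        dualGroth ℓ (n + 1) (extendFin ℓ lam.1) (fun _ => 0) x t) := by
  simp only [← sum_isInner]
  refine HasSum.mul_left _ (hasSum_sum fun T hT => ?_)
  obtain ⟨mu, hmu⟩ := exists_isInner ℓ n lam T (Finset.mem_filter.mp hT).2
  have h := hasSum_single (f := fun mu' : Parts ℓ =>
    if IsInner ℓ n (extendFin ℓ lam.1) (extendFin ℓ mu'.1) T then
      ∏ b, boxWeight ℓ (n + 1) (extendFin ℓ lam.1) (fun _ => 0) x t T b else 0) mu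
    fun mu' hne => if_neg fun h => hne (h.unique hmu)
  rwa [if_pos hmu] at h

theorem dualGroth_nonneg {ℓ n : ℕ} (lam : ℕ → ℕ) (x t : ℕ → ℝ)
    (hx : ∀ i : ℕ, 1 ≤ i → i ≤ n → 0 ≤ x i) (ht : ∀ j : ℕ, 1 ≤ j → j ≤ ℓ → 0 ≤ t j) :
    0 ≤ dualGroth ℓ n lam (fun _ => 0) x t := by
  refine Finset.sum_nonneg fun T hT => Finset.prod_nonneg fun b _ => ?_
  have h0 := (Finset.mem_filter.mp hT).2.1 b
  unfold boxWeight
  split_ifs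
  · exact ht _ (by omega) b.1.2
  · exact hx _ (by omega) (by omega)
  · exact zero_le_one

theorem hasSum_dualGroth_zero (ℓ : ℕ) (x t : ℕ → ℝ) :
    HasSum (fun p : Parts ℓ => (∏ i : Fin ℓ, (t (i.1 + 1))⁻¹ ^ p.1 i) *
      dualGroth ℓ 0 (extendFin ℓ p.1) (fun _ => 0) x t) 1 := by
  let z : Parts ℓ := ⟨fun _ => 0, fun _ _ _ => le_rfl⟩
  have h := hasSum_single (f := fun p : Parts ℓ => (∏ i : Fin ℓ, (t (i.1 + 1))⁻¹ ^ p.1 i) *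
      dualGroth ℓ 0 (extendFin ℓ p.1) (fun _ => 0) x t) z ?_
  · convert h using 1
    have hz : extendFin ℓ z.1 = fun _ => 0 := by
      funext r
      simp [extendFin, z]
    have he : IsEmpty (YBox ℓ fun _ => 0) := ⟨fun b => b.2.elim0⟩
    rw [hz, dualGroth, Finset.filter_true_of_mem]
    · simp [z]
    · intro T _
      exact ⟨fun b => he.elim b, fun r c => c.elim0, fun r r' c => c.elim0⟩
  · intro p hp
    obtain ⟨r, hr⟩ : ∃ r, p.1 r ≠ 0 := by
      by_contra! hcon
      exact hp (Subtype.ext (funext hcon))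
    have hr' : 0 < extendFin ℓ p.1 r := by
      rw [extendFin_of_lt]
      exact Nat.pos_of_ne_zero hr
    rw [dualGroth, Finset.filter_false_of_mem, Finset.sum_empty, mul_zero]
    intro T _ hT
    have := hT.1 ⟨r, ⟨0, hr'⟩⟩
    have hlt := (T ⟨r, ⟨0, hr'⟩⟩).2
    simp only [lt_irrefl, iff_false] at this
    omega

/-- **Weighted dual Cauchy–Littlewood identity / normalization.**
For positive reals `x_i < t_j` (`1 ≤ i ≤ n`, `1 ≤ j ≤ ℓ`), the series
`Σ_λ (∏_{i=1}^{ℓ} t_i^{-λ_i}) g_λ(x_1,…,x_n;t_1,…,t_{ℓ-1})` over all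
partitions `λ` with at most `ℓ` parts (encoded as antitone functions
`Fin ℓ → ℕ`) converges, with sum `∏_{i=1}^{n} ∏_{j=1}^{ℓ} t_j/(t_j-x_i)`. -/
theorem refined_dual_grothendieck_littlewood_series
    (ℓ n : ℕ) (hl : 1 ≤ ℓ) (hn : 1 ≤ n) (x t : ℕ → ℝ)
    (hx : ∀ i : ℕ, 1 ≤ i → i ≤ n → 0 < x i)
    (ht : ∀ j : ℕ, 1 ≤ j → j ≤ ℓ → 0 < t j)
    (hxt : ∀ i j : ℕ, 1 ≤ i → i ≤ n → 1 ≤ j → j ≤ ℓ → x i < t j) :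
    HasSum
      (fun p : {p : Fin ℓ → ℕ // ∀ i j : Fin ℓ, (i : ℕ) ≤ (j : ℕ) → p j ≤ p i} =>
        (∏ i : Fin ℓ, (t (i.1 + 1))⁻¹ ^ p.1 i) *
          dualGroth ℓ n (extendFin ℓ p.1) (fun _ => 0) x t)
      (∏ i ∈ Finset.Icc 1 n, ∏ j ∈ Finset.Icc 1 ℓ, t j / (t j - x i)) := by
  suffices H : ∀ m ≤ n, HasSum (fun p : Parts ℓ => (∏ i : Fin ℓ, (t (i.1 + 1))⁻¹ ^ p.1 i) *
      dualGroth ℓ m (extendFin ℓ p.1) (fun _ => 0) x t)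
      (∏ i ∈ Finset.Icc 1 m, ∏ j ∈ Finset.Icc 1 ℓ, t j / (t j - x i)) from H n le_rfl
  intro m hm
  induction m with
  | zero => simpa using hasSum_dualGroth_zero ℓ x t
  | succ m ih =>
    have hy : 0 < x (m + 1) := hx _ (by omega) hm
    have hyt : ∀ r : Fin ℓ, x (m + 1) < t (r + 1) := fun r =>
      hxt _ _ (by omega) hm (by omega) r.2
    have hprod : ∏ j ∈ Finset.Icc 1 ℓ, t j / (t j - x (m + 1)) =
        ∏ r : Fin ℓ, t (r + 1) / (t (r + 1) - x (m + 1)) := by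
      rw [Fin.prod_univ_eq_prod_range (fun r => t (r + 1) / (t (r + 1) - x (m + 1))),
        Finset.range_eq_Ico, Finset.prod_Ico_add' (fun j => t j / (t j - x (m + 1)))]
      rfl
    rw [Finset.prod_Icc_succ_top (by omega), hprod]
    have hG : ∀ mu : Parts ℓ, 0 ≤ dualGroth ℓ m (extendFin ℓ mu.1) (fun _ => 0) x t := fun mu =>
      dualGroth_nonneg _ x t (fun i h1 h2 => (hx i h1 (by omega)).le) (fun j h1 h2 => (ht j h1 h2).le)
    have hsum := (ih (by omega)).mul_right (∏ r : Fin ℓ, t (r + 1) / (t (r + 1) - x (m + 1)))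
    have hnonneg : ∀ mu p : Parts ℓ, 0 ≤ dualGroth ℓ m (extendFin ℓ mu.1) (fun _ => 0) x t *
        ∏ r : Fin ℓ, rowKernel (t (r + 1)) (x (m + 1)) (mu.1 r) (p.1 r)
          (extendFin ℓ p.1 (r + 1)) := fun mu p =>
      mul_nonneg (hG mu) (Finset.prod_nonneg fun r _ =>
        rowKernel_nonneg (hy.trans (hyt r)).le hy.le _ _ _)
    refine hasSum_comm_of_nonneg hnonneg (fun mu => ?_) hsum (fun p => hasSum_branching p x t)
    rw [mul_comm (∏ i : Fin ℓ, _) (dualGroth _ _ _ _ _ _), mul_assoc]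
    exact (hasSum_transition ℓ t (x (m + 1)) hy hyt mu).mul_left _

end
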